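/- Let E′ be any subset of the edges of the butterfly graph of degree b ≥ 1 and depth d, and fix a source vector s ∈ [b]^d. For each i ∈ {0,…,d−1}, call a function p : {0,…,i} → [b] 'marked' if the edge from (i, v) to (i+1, u) does NOT belong to E′, where u(j) = p(j) for j ≤ i, u(j) = s(j) for j > i, and v agrees with u except that v(i) = s(i). Then for every sink vector t ∈ [b]^d: some restriction of t to {0,…,i} (for some 0 ≤ i < d) is marked if and only if there is no directed path from the source (0, s) to the sink (d, t) using only edges of E′. -/

import Mathlib

/-- The butterfly graph of degree `b` and depth `d` has vertices `(i, v)` with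
`i ∈ {0,…,d}` and `v : Fin d → Fin b`; there is a directed edge from `(i, v)` to
`(i+1, u)` exactly when `i < d` and `v j = u j` for every coordinate `j ≠ i`. -/
def ButterflyEdge (b d : ℕ) (p q : ℕ × (Fin d → Fin b)) : Prop :=
  p.1 < d ∧ q.1 = p.1 + 1 ∧ ∀ j : Fin d, (j : ℕ) ≠ p.1 → p.2 j = q.2 j

/-- A directed path from `u` to `v` with respect to an edge relation `E` is a
(nonempty) sequence of vertices, starting at `u` and ending at `v`, in which
consecutive vertices are joined by an edge. -/
def IsPath {α : Type*} (E : α → α → Prop) (u v : α) (l : List α) : Prop :=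
  l.Chain' E ∧ l.head? = some u ∧ l.getLast? = some v

/-- In Pătrașcu's reduction, for a fixed source vector `s` and edge subset `E'`, a
function `p : {0,…,i} → [b]` (a node at depth `i+1` of the marked-ancestor tree) is
*marked* if the edge from `(i, v)` to `(i+1, u)` does NOT belong to `E'`, where
`u j = p j` for `j ≤ i`, `u j = s j` for `j > i`, and `v` agrees with `u` except
that `v i = s i`. -/
def Marked (b d : ℕ)
    (E' : (ℕ × (Fin d → Fin b)) → (ℕ × (Fin d → Fin b)) → Prop)
    (s : Fin d → Fin b) (i : ℕ) (hi : i < d) (p : Fin (i + 1) → Fin b) : Prop :=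
  ¬ E'
    (i, fun j => if (j : ℕ) = i then s j
        else if h : (j : ℕ) ≤ i then p ⟨(j : ℕ), by omega⟩ else s j)
    (i + 1, fun j => if h : (j : ℕ) ≤ i then p ⟨(j : ℕ), by omega⟩ else s j)

/-- There is a directed path from `u` to `v` exactly when `v` is reachable from `u`. -/
theorem exists_isPath_iff_reflTransGen {α : Type*} {E : α → α → Prop} {u v : α} :
    (∃ l : List α, IsPath E u v l) ↔ Relation.ReflTransGen E u v := by
  constructor
  · rintro ⟨l, hl, hu, hv⟩
    have hl' : l.IsChain E := hl
    cases l with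
    | nil => simp at hu
    | cons a l =>
      obtain rfl : a = u := by simpa using hu
      refine List.relationReflTransGen_of_exists_isChain_cons l hl' ?_
      rw [List.getLast?_eq_some_getLast (List.cons_ne_nil _ _)] at hv
      exact Option.some.inj hv
  · intro h
    obtain ⟨l, hl, hv⟩ := List.exists_isChain_cons_of_relationReflTransGen h
    refine ⟨u :: l, hl, rfl, ?_⟩
    rw [List.getLast?_eq_some_getLast (List.cons_ne_nil _ _), hv]

/-- The vertex in layer `k` whose coordinates below `k` agree with `t` and whose other
coordinates agree with `s`. -/
def butterflyVertex {b d : ℕ} (s t : Fin d → Fin b) (k : ℕ) : ℕ × (Fin d → Fin b) :=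
  (k, fun j => if (j : ℕ) < k then t j else s j)

theorem butterflyVertex_zero {b d : ℕ} (s t : Fin d → Fin b) :
    butterflyVertex s t 0 = (0, s) := by
  simp [butterflyVertex]

theorem butterflyVertex_depth {b d : ℕ} (s t : Fin d → Fin b) :
    butterflyVertex s t d = (d, t) := by
  simp [butterflyVertex]

/-- Reachability in the butterfly graph does not change the coordinates below the layer
of the starting vertex. -/
theorem ButterflyEdge.coord_eq_of_reflTransGen {b d : ℕ} {p q : ℕ × (Fin d → Fin b)}
    (h : Relation.ReflTransGen (ButterflyEdge b d) p q) :
    ∀ j : Fin d, (j : ℕ) < p.1 → p.2 j = q.2 j := by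
  induction h using Relation.ReflTransGen.head_induction_on with
  | refl => exact fun _ _ => rfl
  | head hpr _ ih =>
    intro j hj
    obtain ⟨_, hlayer, hcoord⟩ := hpr
    rw [hcoord j hj.ne]
    exact ih j (by omega)

/-- The butterfly path from `(0, s)` to `(d, t)` is unique: `(d, t)` is reachable by edges
of `E'` exactly when `E'` contains every edge of the canonical path. -/
theorem reflTransGen_source_sink_iff {b d : ℕ}
    {E' : (ℕ × (Fin d → Fin b)) → (ℕ × (Fin d → Fin b)) → Prop}
    (hE' : ∀ p q, E' p q → ButterflyEdge b d p q) (s t : Fin d → Fin b) :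
    Relation.ReflTransGen E' (0, s) (d, t) ↔
      ∀ i < d, E' (butterflyVertex s t i) (butterflyVertex s t (i + 1)) := by
  constructor
  · intro h
    have step : ∀ i < d, Relation.ReflTransGen E' (butterflyVertex s t i) (d, t) →
        E' (butterflyVertex s t i) (butterflyVertex s t (i + 1)) ∧
          Relation.ReflTransGen E' (butterflyVertex s t (i + 1)) (d, t) := by
      intro i hi hreach
      rcases hreach.cases_head with heq | ⟨q, hq, hreach'⟩
      · exact absurd (congrArg Prod.fst heq) hi.ne
      · obtain ⟨_, hlayer, hcoord⟩ := hE' _ _ hq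
        have hsink := ButterflyEdge.coord_eq_of_reflTransGen (Relation.ReflTransGen.mono hE' _ _ hreach')
        have hqi : q = butterflyVertex s t (i + 1) := by
          refine Prod.ext hlayer (funext fun j => ?_)
          simp only [butterflyVertex] at hlayer hcoord ⊢
          split_ifs with hj
          · exact hsink j (by omega)
          · rw [← hcoord j (by omega), if_neg (by omega)]
        exact hqi ▸ ⟨hq, hreach'⟩
    have reach : ∀ i ≤ d, Relation.ReflTransGen E' (butterflyVertex s t i) (d, t) := by
      intro i
      induction i with
      | zero => exact fun _ => (butterflyVertex_zero s t).symm ▸ h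
      | succ i ih => exact fun hi => (step i hi (ih (by omega))).2
    exact fun i hi => (step i hi (reach i hi.le)).1
  · intro h
    have reach : ∀ i ≤ d, Relation.ReflTransGen E' (0, s) (butterflyVertex s t i) := by
      intro i
      induction i with
      | zero => exact fun _ => (butterflyVertex_zero s t).symm ▸ .refl
      | succ i ih => exact fun hi => (ih (by omega)).tail (h i hi)
    exact butterflyVertex_depth s t ▸ reach d le_rfl

/-- A restriction of `t` is marked exactly when the corresponding edge of the canonical
path is missing. -/
theorem marked_restrict_iff {b d : ℕ}
    (E' : (ℕ × (Fin d → Fin b)) → (ℕ × (Fin d → Fin b)) → Prop)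
    (s t : Fin d → Fin b) (i : ℕ) (hi : i < d) :
    Marked b d E' s i hi
        (fun j : Fin (i + 1) => t ⟨(j : ℕ), Nat.lt_of_lt_of_le j.isLt hi⟩) ↔
      ¬ E' (butterflyVertex s t i) (butterflyVertex s t (i + 1)) := by
  unfold Marked butterflyVertex
  have hv : ∀ j : Fin d, (if (j : ℕ) = i then s j else if (j : ℕ) ≤ i then t j else s j) =
      if (j : ℕ) < i then t j else s j := by
    intro j
    split_ifs <;> first | rfl | omega
  simp [hv]

/-- Let `E'` be any subset of the edges of the butterfly graph of degree `b ≥ 1` and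
depth `d`, and fix a source vector `s`. For every sink vector `t`: some restriction
of `t` to `{0,…,i}` (for some `0 ≤ i < d`) is marked if and only if there is no
directed path from the source `(0, s)` to the sink `(d, t)` using only edges
of `E'`. -/
theorem butterfly_marked_ancestor_correct (b d : ℕ) (hb : 1 ≤ b)
    (E' : (ℕ × (Fin d → Fin b)) → (ℕ × (Fin d → Fin b)) → Prop)
    (hE' : ∀ p q, E' p q → ButterflyEdge b d p q)
    (s t : Fin d → Fin b) :
    (∃ i : ℕ, ∃ hi : i < d,
        Marked b d E' s i hi
          (fun j : Fin (i + 1) => t ⟨(j : ℕ), Nat.lt_of_lt_of_le j.isLt hi⟩)) ↔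
      ¬ ∃ l : List (ℕ × (Fin d → Fin b)), IsPath E' (0, s) (d, t) l := by
  simp only [marked_restrict_iff, exists_isPath_iff_reflTransGen,
    reflTransGen_source_sink_iff hE', not_forall, exists_prop]
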